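/- (Zalcman-type lemma) Let P be a closed property for holomorphic maps into the Riemann sphere. Then at least one of the following holds: (i) P is a compact property; (ii) there exists f ∈ 𝒫(ℂ) (a nonconstant meromorphic function on ℂ satisfying P) such that |∇f|_e(0) = 1 and |∇f|_e(z) ≤ 1 for all z ∈ ℂ, where |∇f|_e = 2√2 |f'| / (1 + |f|²) is the length of the Euclidean gradient of the composition of f with the stereographic projection (i.e., 2√2 times the spherical derivative). -/

import Mathlib

open Filter Set MeasureTheory Topology
open scoped ENNReal

noncomputable section

/-- Half of the chordal (spherical) distance on the Riemann sphere `OnePoint ℂ`. -/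
def sphDist : OnePoint ℂ → OnePoint ℂ → ℝ
  | OnePoint.infty, OnePoint.infty => 0
  | OnePoint.infty, (w : ℂ) => 1 / Real.sqrt (1 + ‖w‖ ^ 2)
  | (z : ℂ), OnePoint.infty => 1 / Real.sqrt (1 + ‖z‖ ^ 2)
  | (z : ℂ), (w : ℂ) => ‖z - w‖ / (Real.sqrt (1 + ‖z‖ ^ 2) * Real.sqrt (1 + ‖w‖ ^ 2))

/-- A map `f : ℂ → Ĉ` is holomorphic on `U` if near each point of `U` it is, in the chart,
either a coerced holomorphic function or the reciprocal of a holomorphic function. -/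
def SphHolomorphicOn (f : ℂ → OnePoint ℂ) (U : Set ℂ) : Prop :=
  ∀ z ∈ U, ∃ V : Set ℂ, IsOpen V ∧ z ∈ V ∧ ∃ h : ℂ → ℂ, DifferentiableOn ℂ h V ∧
    ((∀ w ∈ V, f w = (h w : OnePoint ℂ)) ∨
     (∀ w ∈ V, f w = if h w = 0 then OnePoint.infty else (((h w)⁻¹ : ℂ) : OnePoint ℂ)))

/-- Locally uniform convergence on `U` with respect to the spherical distance. -/
def SphLocUnifOn (F : ℕ → ℂ → OnePoint ℂ) (f : ℂ → OnePoint ℂ) (U : Set ℂ) : Prop :=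
  ∀ K : Set ℂ, K ⊆ U → IsCompact K → ∀ ε > (0:ℝ),
    ∀ᶠ n in Filter.atTop, ∀ z ∈ K, sphDist (F n z) (f z) < ε

/-- Locally uniform convergence of real-valued functions on `U`. -/
def RealLocUnifOn (F : ℕ → ℂ → ℝ) (f : ℂ → ℝ) (U : Set ℂ) : Prop :=
  ∀ K : Set ℂ, K ⊆ U → IsCompact K → ∀ ε > (0:ℝ),
    ∀ᶠ n in Filter.atTop, ∀ z ∈ K, |F n z - f z| < ε

/-- A closed property for holomorphic maps into the Riemann sphere (on plane domains). -/
structure IsClosedProperty (P : Set ℂ → (ℂ → OnePoint ℂ) → Prop) : Prop where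
  mem_holo : ∀ (U : Set ℂ) (f : ℂ → OnePoint ℂ), IsOpen U → IsConnected U →
    P U f → SphHolomorphicOn f U
  /-- (P1): stability under precomposition with unramified holomorphic maps. -/
  comp : ∀ (U V : Set ℂ) (φ : ℂ → ℂ) (f : ℂ → OnePoint ℂ),
    IsOpen U → IsConnected U → IsOpen V → IsConnected V →
    DifferentiableOn ℂ φ U → Set.MapsTo φ U V → (∀ z ∈ U, deriv φ z ≠ 0) →
    P V f → P U (f ∘ φ)
  /-- (P2): if `f` has the property on every relatively compact subdomain, it has it globally. -/
  exhaust : ∀ (U : Set ℂ) (f : ℂ → OnePoint ℂ), IsOpen U → IsConnected U →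
    SphHolomorphicOn f U →
    (∀ Ω : Set ℂ, IsOpen Ω → IsConnected Ω → IsCompact (closure Ω) → closure Ω ⊆ U → P Ω f) →
    P U f
  /-- (P3): `𝒫(U)` is closed under locally uniform spherical convergence in `𝑀(U)`. -/
  closed : ∀ (U : Set ℂ) (f : ℂ → OnePoint ℂ) (F : ℕ → ℂ → OnePoint ℂ),
    IsOpen U → IsConnected U → (∀ n, P U (F n)) → SphLocUnifOn F f U →
    SphHolomorphicOn f U → P U f

/-- A compact property: a closed property all of whose families `𝒫(U)` are normal. -/
structure IsCompactProperty (P : Set ℂ → (ℂ → OnePoint ℂ) → Prop) extends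
    IsClosedProperty P : Prop where
  /-- (P4): normality of `𝒫(U)` for every domain `U`. -/
  normal : ∀ (U : Set ℂ), IsOpen U → IsConnected U →
    ∀ F : ℕ → ℂ → OnePoint ℂ, (∀ n, P U (F n)) →
      ∃ φ : ℕ → ℕ, StrictMono φ ∧ ∃ g : ℂ → OnePoint ℂ, SphLocUnifOn (F ∘ φ) g U

/-- The spherical derivative of a map into the Riemann sphere (limit of spherical
difference quotients). For `f` meromorphic near `z` this equals `|f'|/(1+|f|²)`. -/
def sphD (f : ℂ → OnePoint ℂ) (z : ℂ) : ℝ :=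
  limUnder (𝓝[≠] z) (fun w => sphDist (f w) (f z) / ‖w - z‖)

/-- A Weierstrass `m`-triple on a plane domain `U`: a holomorphic `1`-form `f dz`, a
meromorphic function `g`, and the (continuous positive) conformal density `lam` of the
metric `ds² = (1+|g|²)^m |f|² |dz|²`. -/
structure WeierstrassTriple (m : ℕ) (U : Set ℂ) where
  isOpen : IsOpen U
  isConnected : IsConnected U
  f : ℂ → ℂ
  g : ℂ → OnePoint ℂ
  f_holo : DifferentiableOn ℂ f U
  g_holo : SphHolomorphicOn g U
  g_mero : ∃ z ∈ U, g z ≠ OnePoint.infty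
  lam : ℂ → ℝ
  lam_cont : ContinuousOn lam U
  lam_pos : ∀ z ∈ U, 0 < lam z
  lam_eq : ∀ z ∈ U, ∀ w : ℂ, g z = (w : OnePoint ℂ) →
    lam z = (1 + ‖w‖ ^ 2) ^ ((m : ℝ) / 2) * ‖f z‖

/-- The Gaussian curvature `K = -2m |g'|²/((1+|g|²)^{m+2}|f|²)` of a Weierstrass
`m`-triple, written via the spherical derivative: `K = -2m (g^#)² / λ²`. -/
def WeierstrassTriple.curv {m : ℕ} {U : Set ℂ} (T : WeierstrassTriple m U) (z : ℂ) : ℝ :=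
  -(2 * m) * (sphD T.g z) ^ 2 / (T.lam z) ^ 2

/-- A divergent `C¹` path in `U` starting at `p`, parametrized by `[0,1)`. -/
structure DivergentPath (U : Set ℂ) (p : ℂ) where
  toFun : ℝ → ℂ
  start : toFun 0 = p
  mem : ∀ t ∈ Set.Ico (0:ℝ) 1, toFun t ∈ U
  cont : ContinuousOn toFun (Set.Ico (0:ℝ) 1)
  diff : ∀ t ∈ Set.Ioo (0:ℝ) 1, DifferentiableAt ℝ toFun t
  divergent : ∀ K : Set ℂ, IsCompact K → K ⊆ U →
    ∃ t₀ ∈ Set.Ico (0:ℝ) 1, ∀ t, t₀ ≤ t → t < 1 → toFun t ∉ K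

/-- The length of a path with respect to the conformal metric with density `lam`. -/
def pathLen (lam : ℂ → ℝ) (γ : ℝ → ℂ) : ℝ≥0∞ :=
  ∫⁻ t in Set.Ioo (0:ℝ) 1, ENNReal.ofReal (lam (γ t) * ‖deriv γ t‖)

/-- The geodesic distance from `p` to the boundary of `U`: the infimum of lengths of
divergent paths starting at `p`. -/
def distToBdry (lam : ℂ → ℝ) (U : Set ℂ) (p : ℂ) : ℝ≥0∞ :=
  ⨅ γ : DivergentPath U p, pathLen lam γ.toFun

/-- Completeness of the conformal metric with density `lam` on `U`: every divergent path
has infinite length. -/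
def IsCompleteMetric (lam : ℂ → ℝ) (U : Set ℂ) : Prop :=
  ∀ p ∈ U, ∀ γ : DivergentPath U p, pathLen lam γ.toFun = ⊤

/-- The property `P_L`: `|f| < L` on `U`, or `f` is constant on `U`. -/
def PL (L : ℝ) (U : Set ℂ) (f : ℂ → OnePoint ℂ) : Prop :=
  SphHolomorphicOn f U ∧
    ((∀ z ∈ U, ∃ w : ℂ, f z = (w : OnePoint ℂ) ∧ ‖w‖ < L) ∨
      (∀ z ∈ U, ∀ w ∈ U, f z = f w))

/-- The property `P_X`: `f` omits every value of `X`, or `f` is constant on `U`. -/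
def PX (X : Set (OnePoint ℂ)) (U : Set ℂ) (f : ℂ → OnePoint ℂ) : Prop :=
  SphHolomorphicOn f U ∧ ((∀ z ∈ U, f z ∉ X) ∨ (∀ z ∈ U, ∀ w ∈ U, f z = f w))

/-- Second directional derivative of `u : ℂ → ℝ` at `z` in direction `v`. -/
def dirDeriv2 (u : ℂ → ℝ) (z v : ℂ) : ℝ :=
  deriv (deriv (fun t : ℝ => u (z + t • v))) 0

/-- The Euclidean Laplacian of `u : ℂ → ℝ`. -/
def laplacian (u : ℂ → ℝ) (z : ℂ) : ℝ :=
  dirDeriv2 u z 1 + dirDeriv2 u z Complex.I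


/-- A compact property `P` satisfies the `m`-curvature estimate if there is `C > 0` such
that `|K| d² ≤ C` for every Weierstrass `m`-triple whose meromorphic function satisfies `P`. -/
def SatisfiesCurvatureEstimate (P : Set ℂ → (ℂ → OnePoint ℂ) → Prop) (m : ℕ) : Prop :=
  ∃ C : ℝ, 0 < C ∧ ∀ (U : Set ℂ) (T : WeierstrassTriple m U), P U T.g →
    ∀ p ∈ U, ENNReal.ofReal |T.curv p| * (distToBdry T.lam U p) ^ 2 ≤ ENNReal.ofReal C

/-! ### The Riemann sphere as a metric space -/

lemma sphDist_coe_coe (z w : ℂ) : sphDist (z : OnePoint ℂ) (w : OnePoint ℂ) =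
    ‖z - w‖ / (Real.sqrt (1 + ‖z‖ ^ 2) * Real.sqrt (1 + ‖w‖ ^ 2)) := rfl

lemma sphDist_infty_coe (w : ℂ) : sphDist OnePoint.infty (w : OnePoint ℂ) =
    1 / Real.sqrt (1 + ‖w‖ ^ 2) := rfl

lemma sphDist_coe_infty (z : ℂ) : sphDist (z : OnePoint ℂ) OnePoint.infty =
    1 / Real.sqrt (1 + ‖z‖ ^ 2) := rfl

lemma sphDist_infty_infty : sphDist OnePoint.infty OnePoint.infty = 0 := rfl

lemma sphDist_nonneg (x y : OnePoint ℂ) : 0 ≤ sphDist x y := by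
  induction x using OnePoint.rec <;> induction y using OnePoint.rec <;>
    simp only [sphDist_coe_coe, sphDist_infty_coe, sphDist_coe_infty, sphDist_infty_infty] <;>
    positivity

/-- Stereographic projection onto the sphere of diameter `1` in `ℂ × ℝ` centred at
`(0, 1 / 2)`. -/
def stereo (x : OnePoint ℂ) : WithLp 2 (ℂ × ℝ) :=
  x.elim (WithLp.toLp 2 (0, 1))
    fun z => WithLp.toLp 2 (((1 + ‖z‖ ^ 2)⁻¹ : ℝ) • z, ‖z‖ ^ 2 * (1 + ‖z‖ ^ 2)⁻¹)

lemma stereo_infty : stereo OnePoint.infty = WithLp.toLp 2 (0, 1) := rfl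

lemma stereo_infty_fst : (stereo OnePoint.infty).fst = 0 := rfl

lemma stereo_infty_snd : (stereo OnePoint.infty).snd = 1 := rfl

lemma stereo_coe (z : ℂ) : stereo (z : OnePoint ℂ) =
    WithLp.toLp 2 (((1 + ‖z‖ ^ 2)⁻¹ : ℝ) • z, ‖z‖ ^ 2 * (1 + ‖z‖ ^ 2)⁻¹) := rfl

lemma stereo_coe_fst (z : ℂ) :
    (stereo (z : OnePoint ℂ)).fst = ((1 + ‖z‖ ^ 2)⁻¹ : ℝ) • z := rfl

lemma stereo_coe_snd (z : ℂ) :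
    (stereo (z : OnePoint ℂ)).snd = ‖z‖ ^ 2 * (1 + ‖z‖ ^ 2)⁻¹ := rfl

lemma dist_stereo_sq (x y : OnePoint ℂ) : dist (stereo x) (stereo y) ^ 2 = sphDist x y ^ 2 := by
  rw [dist_eq_norm, WithLp.prod_norm_sq_eq_of_L2]
  induction x using OnePoint.rec with
  | infty =>
    induction y using OnePoint.rec with
    | infty => simp [sphDist_infty_infty]
    | coe w =>
      have hw : (0 : ℝ) < 1 + ‖w‖ ^ 2 := by positivity
      rw [sphDist_infty_coe]
      simp only [WithLp.sub_fst, WithLp.sub_snd, stereo_infty_fst, stereo_infty_snd, stereo_coe_fst, stereo_coe_snd,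
        zero_sub, norm_neg, norm_smul, div_pow,
        Real.sq_sqrt hw.le, Real.norm_eq_abs, sq_abs, mul_pow]
      field_simp
      ring
  | coe z =>
    have hz : (0 : ℝ) < 1 + ‖z‖ ^ 2 := by positivity
    induction y using OnePoint.rec with
    | infty =>
      rw [sphDist_coe_infty]
      simp only [WithLp.sub_fst, WithLp.sub_snd, stereo_infty_fst, stereo_infty_snd, stereo_coe_fst, stereo_coe_snd,
        sub_zero, norm_smul, div_pow,
        Real.sq_sqrt hz.le, Real.norm_eq_abs, sq_abs, mul_pow]
      field_simp
      ring
    | coe w =>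
      have hw : (0 : ℝ) < 1 + ‖w‖ ^ 2 := by positivity
      rw [sphDist_coe_coe]
      simp only [WithLp.sub_fst, WithLp.sub_snd, stereo_coe_fst, stereo_coe_snd, div_pow, mul_pow,
        Real.sq_sqrt hz.le, Real.sq_sqrt hw.le, Real.norm_eq_abs, sq_abs]
      simp only [← Complex.normSq_eq_norm_sq] at hz hw ⊢
      simp only [Complex.normSq_apply, Complex.sub_re, Complex.sub_im, Complex.smul_re,
        Complex.smul_im, smul_eq_mul] at hz hw ⊢
      field_simp
      ring

lemma dist_stereo (x y : OnePoint ℂ) : dist (stereo x) (stereo y) = sphDist x y :=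
  (sq_eq_sq₀ dist_nonneg (sphDist_nonneg x y)).1 (dist_stereo_sq x y)

lemma sphDist_self (x : OnePoint ℂ) : sphDist x x = 0 := by
  rw [← dist_stereo, dist_self]

lemma sphDist_comm (x y : OnePoint ℂ) : sphDist x y = sphDist y x := by
  rw [← dist_stereo, dist_comm, dist_stereo]

lemma sphDist_triangle (x y z : OnePoint ℂ) : sphDist x z ≤ sphDist x y + sphDist y z := by
  simpa only [dist_stereo] using dist_triangle (stereo x) (stereo y) (stereo z)

lemma range_stereo :
    range stereo = {v : WithLp 2 (ℂ × ℝ) | ‖v.fst‖ ^ 2 + v.snd ^ 2 = v.snd} := by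
  ext v
  constructor
  · rintro ⟨x, rfl⟩
    induction x using OnePoint.rec with
    | infty => simp [stereo_infty_fst, stereo_infty_snd]
    | coe z =>
      have hz : (0 : ℝ) < 1 + ‖z‖ ^ 2 := by positivity
      simp only [stereo_coe_fst, stereo_coe_snd, mem_ofPred_eq, norm_smul, Real.norm_eq_abs, mul_pow, sq_abs]
      field_simp
  · intro hv
    rw [mem_ofPred_eq] at hv
    by_cases h1 : v.snd = 1
    · refine ⟨OnePoint.infty, ?_⟩
      have h0 : v.fst = 0 := by simpa [h1] using hv
      rw [stereo_infty]
      refine WithLp.ofLp_injective 2 (Prod.ext ?_ ?_)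
      exacts [h0.symm, h1.symm]
    · have h1' : 1 - v.snd ≠ 0 := sub_ne_zero.2 (Ne.symm h1)
      have hn : ‖v.fst‖ ^ 2 = v.snd * (1 - v.snd) := by linarith
      have hz : ‖((1 - v.snd)⁻¹ : ℝ) • v.fst‖ ^ 2 = v.snd / (1 - v.snd) := by
        rw [norm_smul, mul_pow, hn, Real.norm_eq_abs, sq_abs]
        field_simp
      have hz' : 1 + v.snd / (1 - v.snd) = (1 - v.snd)⁻¹ := by
        field_simp
        ring
      refine ⟨(((1 - v.snd)⁻¹ : ℝ) • v.fst : ℂ), ?_⟩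
      rw [stereo_coe, hz, hz']
      refine WithLp.ofLp_injective 2 (Prod.ext ?_ ?_)
      · change ((1 - v.snd)⁻¹)⁻¹ • (1 - v.snd)⁻¹ • v.fst = v.fst
        rw [smul_smul, inv_inv, mul_inv_cancel₀ h1', one_smul]
      · simp [h1']

lemma isCompact_range_stereo : IsCompact (range stereo) := by
  refine Metric.isCompact_of_isClosed_isBounded ?_ ?_
  · rw [range_stereo]
    have h1 : Continuous fun v : WithLp 2 (ℂ × ℝ) => v.fst := by fun_prop
    have h2 : Continuous fun v : WithLp 2 (ℂ × ℝ) => v.snd := by fun_prop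
    exact isClosed_eq (by fun_prop) h2
  · rw [range_stereo]
    refine Metric.isBounded_closedBall (x := 0) (r := 1) |>.subset fun v hv => ?_
    rw [mem_ofPred_eq] at hv
    rw [mem_closedBall_zero_iff, ← sq_le_one_iff₀ (norm_nonneg _),
      WithLp.prod_norm_sq_eq_of_L2, Real.norm_eq_abs, sq_abs, hv]
    nlinarith [sq_nonneg ‖v.fst‖, sq_nonneg (v.snd - 1)]

/-- The involution `z ↦ 1 / z` of the Riemann sphere. -/
def sphInv (x : OnePoint ℂ) : OnePoint ℂ :=
  x.elim ((0 : ℂ) : OnePoint ℂ) fun z => if z = 0 then OnePoint.infty else ((z⁻¹ : ℂ) : OnePoint ℂ)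

lemma sphInv_infty : sphInv OnePoint.infty = ((0 : ℂ) : OnePoint ℂ) := rfl

lemma sphInv_coe (z : ℂ) :
    sphInv (z : OnePoint ℂ) = if z = 0 then OnePoint.infty else ((z⁻¹ : ℂ) : OnePoint ℂ) := rfl

lemma sphInv_sphInv (x : OnePoint ℂ) : sphInv (sphInv x) = x := by
  induction x using OnePoint.rec with
  | infty => simp [sphInv_infty, sphInv_coe]
  | coe z =>
    by_cases hz : z = 0
    · simp [sphInv_infty, sphInv_coe, hz]
    · simp [sphInv_coe, hz]

lemma sqrt_one_add_norm_inv_sq {z : ℂ} (hz : z ≠ 0) :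
    √(1 + ‖z⁻¹‖ ^ 2) = √(1 + ‖z‖ ^ 2) / ‖z‖ := by
  have hz' : 0 < ‖z‖ := norm_pos_iff.2 hz
  rw [← Real.sqrt_sq hz'.le, ← Real.sqrt_div (by positivity), Real.sqrt_sq hz'.le, norm_inv]
  congr 1
  field_simp
  ring

lemma sphDist_sphInv (x y : OnePoint ℂ) : sphDist (sphInv x) (sphInv y) = sphDist x y := by
  have key (w : ℂ) : sphDist (sphInv OnePoint.infty) (sphInv w) = sphDist OnePoint.infty w := by
    rw [sphInv_infty, sphInv_coe, sphDist_infty_coe]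
    split_ifs with h
    · simp [sphDist_coe_infty, h]
    · have hw : 0 < ‖w‖ := norm_pos_iff.2 h
      rw [sphDist_coe_coe, sqrt_one_add_norm_inv_sq h]
      simp
      field_simp
  have key0 (w : ℂ) : sphDist (sphInv (0 : ℂ)) (sphInv w) = sphDist (0 : ℂ) w := by
    rw [sphInv_coe, if_pos rfl, sphInv_coe]
    split_ifs with h
    · simp [h, sphDist_self]
    · have hw : 0 < ‖w‖ := norm_pos_iff.2 h
      rw [sphDist_infty_coe, sphDist_coe_coe, sqrt_one_add_norm_inv_sq h]
      simp
  induction x using OnePoint.rec with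
  | infty =>
    induction y using OnePoint.rec with
    | infty => rw [sphDist_self, sphDist_self]
    | coe w => exact key w
  | coe z =>
    induction y using OnePoint.rec with
    | infty => rw [sphDist_comm, key, sphDist_comm]
    | coe w =>
      by_cases hz : z = 0
      · rw [hz, key0]
      by_cases hw : w = 0
      · rw [hw, sphDist_comm, key0, sphDist_comm]
      have hz' : 0 < ‖z‖ := norm_pos_iff.2 hz
      have hw' : 0 < ‖w‖ := norm_pos_iff.2 hw
      rw [sphInv_coe, sphInv_coe, if_neg hz, if_neg hw, sphDist_coe_coe, sphDist_coe_coe,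
        sqrt_one_add_norm_inv_sq hz, sqrt_one_add_norm_inv_sq hw, inv_sub_inv hz hw,
        norm_div, norm_mul, norm_sub_rev w z]
      field_simp

/-! ### The spherical derivative -/

/-- `f` has spherical derivative `d` at `z`. -/
def HasSphD (f : ℂ → OnePoint ℂ) (z : ℂ) (d : ℝ) : Prop :=
  Tendsto (fun w => sphDist (f w) (f z) / ‖w - z‖) (𝓝[≠] z) (𝓝 d)

lemma HasSphD.sphD_eq {f : ℂ → OnePoint ℂ} {z : ℂ} {d : ℝ} (h : HasSphD f z d) :
    sphD f z = d :=
  h.limUnder_eq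

lemma HasSphD.congr {f g : ℂ → OnePoint ℂ} {z : ℂ} {d : ℝ} (h : HasSphD f z d)
    (hfg : g =ᶠ[𝓝 z] f) : HasSphD g z d := by
  refine Tendsto.congr' ?_ h
  filter_upwards [hfg.filter_mono nhdsWithin_le_nhds] with w hw
  rw [hw, hfg.self_of_nhds]

lemma hasSphD_sphInv_comp_iff {f : ℂ → OnePoint ℂ} {z : ℂ} {d : ℝ} :
    HasSphD (sphInv ∘ f) z d ↔ HasSphD f z d := by
  simp only [HasSphD, Function.comp_apply, sphDist_sphInv]

lemma hasSphD_coe {h : ℂ → ℂ} {z : ℂ} (hh : DifferentiableAt ℂ h z) :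
    HasSphD (fun w => (h w : OnePoint ℂ)) z (‖deriv h z‖ / (1 + ‖h z‖ ^ 2)) := by
  have h1 : Tendsto (fun w => ‖slope h z w‖) (𝓝[≠] z) (𝓝 ‖deriv h z‖) :=
    (hasDerivAt_iff_tendsto_slope.1 hh.hasDerivAt).norm
  have h2 : Tendsto h (𝓝[≠] z) (𝓝 (h z)) := hh.continuousAt.tendsto.mono_left nhdsWithin_le_nhds
  have h3 : Tendsto (fun w => √(1 + ‖h w‖ ^ 2) * √(1 + ‖h z‖ ^ 2)) (𝓝[≠] z)
      (𝓝 (√(1 + ‖h z‖ ^ 2) * √(1 + ‖h z‖ ^ 2))) :=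
    ((h2.norm.pow 2).const_add 1).sqrt.mul_const _
  have h4 := h1.div h3 (by positivity)
  rw [Real.mul_self_sqrt (by positivity)] at h4
  refine h4.congr fun w => ?_
  rw [Pi.div_apply, sphDist_coe_coe, slope_def_field, norm_div, div_right_comm]

lemma HasSphD.comp_affine {f : ℂ → OnePoint ℂ} {p ζ : ℂ} {ρ d : ℝ} (hρ : 0 < ρ)
    (h : HasSphD f (p + ρ * ζ) d) : HasSphD (fun ζ => f (p + ρ * ζ)) ζ (ρ * d) := by
  have hρ' : (ρ : ℂ) ≠ 0 := by exact_mod_cast hρ.ne'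
  have hinj : Function.Injective fun ζ : ℂ => p + ρ * ζ := fun a b hab =>
    mul_left_cancel₀ hρ' (add_left_cancel hab)
  have hcont : Continuous fun ζ : ℂ => p + ρ * ζ := by fun_prop
  have ht : Tendsto (fun ζ : ℂ => p + ρ * ζ) (𝓝[≠] ζ) (𝓝[≠] (p + ρ * ζ)) :=
    hcont.continuousAt.continuousWithinAt.tendsto_nhdsWithin fun w hw => hinj.ne hw
  refine ((h.comp ht).const_mul ρ).congr fun w => ?_
  have : p + ρ * w - (p + ρ * ζ) = ρ * (w - ζ) := by ring
  rw [Function.comp_apply, this, norm_mul, Complex.norm_real, Real.norm_of_nonneg hρ.le]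
  field_simp

lemma HasSphD.le_of_lipschitz {f : ℂ → OnePoint ℂ} {z : ℂ} {d L : ℝ} (h : HasSphD f z d)
    (hL : ∀ᶠ w in 𝓝 z, sphDist (f w) (f z) ≤ L * ‖w - z‖) : d ≤ L := by
  refine le_of_tendsto h ?_
  filter_upwards [hL.filter_mono nhdsWithin_le_nhds, self_mem_nhdsWithin] with w hw hne
  exact (div_le_iff₀ (norm_pos_iff.2 (sub_ne_zero.2 hne))).2 hw

lemma HasSphD.tendsto_sphDist {f : ℂ → OnePoint ℂ} {z : ℂ} {d : ℝ} (h : HasSphD f z d) :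
    Tendsto (fun w => sphDist (f w) (f z)) (𝓝 z) (𝓝 0) := by
  have h1 : Tendsto (fun w => ‖w - z‖) (𝓝 z) (𝓝 0) := by
    have : Continuous fun w => ‖w - z‖ := by fun_prop
    simpa using this.tendsto z
  have h2 : Tendsto (fun w => sphDist (f w) (f z)) (𝓝[≠] z) (𝓝 0) := by
    have := Tendsto.mul h (h1.mono_left nhdsWithin_le_nhds)
    rw [mul_zero] at this
    refine this.congr' ?_
    filter_upwards [self_mem_nhdsWithin] with w hw
    exact div_mul_cancel₀ _ (norm_ne_zero_iff.2 (sub_ne_zero.2 hw))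
  have h3 := continuousWithinAt_compl_self.1
    (show ContinuousWithinAt (fun w => sphDist (f w) (f z)) {z}ᶜ z by
      simpa [ContinuousWithinAt, sphDist_self] using h2)
  simpa [ContinuousAt, sphDist_self] using h3

/-- A mean value inequality: a bound on the spherical derivative on a convex set gives a
Lipschitz bound. -/
lemma sphDist_le_of_hasSphD_le {f : ℂ → OnePoint ℂ} {s : Set ℂ} (hs : Convex ℝ s)
    {d : ℂ → ℝ} {M : ℝ} (hf : ∀ z ∈ s, HasSphD f z (d z)) (hd : ∀ z ∈ s, d z ≤ M)
    {a b : ℂ} (ha : a ∈ s) (hb : b ∈ s) : sphDist (f b) (f a) ≤ M * ‖b - a‖ := by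
  rcases eq_or_ne b a with rfl | hab
  · simp [sphDist_self]
  have hL : 0 < ‖b - a‖ := norm_pos_iff.2 (sub_ne_zero.2 hab)
  set γ : ℝ → ℂ := fun t => a + t * (b - a) with hγ
  have hγs : ∀ t ∈ Icc (0 : ℝ) 1, γ t ∈ s := fun t ht => by
    simpa [hγ] using hs.add_smul_sub_mem ha hb ht
  have hγc : Continuous γ := by fun_prop
  have hγd : ∀ t u, ‖γ u - γ t‖ = |u - t| * ‖b - a‖ := fun t u => by
    rw [← Real.norm_eq_abs, ← Complex.norm_real, ← norm_mul]
    congr 1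
    simp only [hγ]
    push_cast
    ring
  have hcont : ContinuousOn (fun t => sphDist (f (γ t)) (f a)) (Icc 0 1) := by
    intro t ht
    have h1 := ((hf _ (hγs t ht)).tendsto_sphDist).comp (hγc.tendsto t)
    refine ContinuousAt.continuousWithinAt (tendsto_iff_dist_tendsto_zero.2 ?_)
    refine squeeze_zero (fun _ => dist_nonneg) (fun u => ?_) h1
    rw [Real.dist_eq, abs_sub_le_iff, Function.comp_apply]
    constructor
    · linarith [sphDist_triangle (f (γ u)) (f (γ t)) (f a)]
    · linarith [sphDist_triangle (f (γ t)) (f (γ u)) (f a), sphDist_comm (f (γ t)) (f (γ u))]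
  have key : ∀ ε > 0, sphDist (f b) (f a) ≤ (M + ε) * ‖b - a‖ := by
    intro ε hε
    have := image_le_of_liminf_slope_right_lt_deriv_boundary' (a := 0) (b := 1)
      (f := fun t => sphDist (f (γ t)) (f a)) (f' := fun _ => M * ‖b - a‖)
      (B := fun t => (M + ε) * ‖b - a‖ * t) (B' := fun _ => (M + ε) * ‖b - a‖)
      hcont ?_ (by simp [hγ, sphDist_self]) (by fun_prop) ?_ ?_
      (right_mem_Icc.2 zero_le_one)
    · simpa [hγ] using this
    · intro t ht r hr
      have htI : t ∈ Icc (0 : ℝ) 1 := ⟨ht.1, ht.2.le⟩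
      have hev : ∀ᶠ w in 𝓝[≠] (γ t), sphDist (f w) (f (γ t)) / ‖w - γ t‖ < r / ‖b - a‖ := by
        refine (hf _ (hγs t htI)).eventually_lt_const ?_
        rw [lt_div_iff₀ hL]
        exact (mul_le_mul_of_nonneg_right (hd _ (hγs t htI)) hL.le).trans_lt hr
      have ht' : Tendsto γ (𝓝[>] t) (𝓝[≠] (γ t)) := by
        refine hγc.continuousAt.continuousWithinAt.tendsto_nhdsWithin fun u hu => ?_
        rw [mem_compl_singleton_iff, ← sub_ne_zero, ← norm_ne_zero_iff, hγd]
        exact mul_ne_zero (abs_ne_zero.2 (sub_ne_zero.2 (ne_of_gt hu))) hL.ne'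
      refine Eventually.frequently ?_
      filter_upwards [ht'.eventually hev, self_mem_nhdsWithin] with u hu htu
      have htu' : 0 < u - t := sub_pos.2 htu
      rw [hγd, abs_of_pos htu', div_lt_div_iff₀ (mul_pos htu' hL) hL] at hu
      rw [slope_def_field, div_lt_iff₀ htu']
      have := sphDist_triangle (f (γ u)) (f (γ t)) (f a)
      nlinarith
    · intro t _
      simpa using ((hasDerivAt_id t).const_mul ((M + ε) * ‖b - a‖)).hasDerivWithinAt
    · intro t _ _
      exact mul_lt_mul_of_pos_right (by linarith) hL
  refine le_of_forall_pos_le_add fun ε hε => ?_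
  have := key (ε / ‖b - a‖) (by positivity)
  rwa [add_mul, div_mul_cancel₀ _ hL.ne'] at this

/-! ### Holomorphic maps into the Riemann sphere -/

lemma SphHolomorphicOn.exists_chart {f : ℂ → OnePoint ℂ} {U : Set ℂ}
    (hf : SphHolomorphicOn f U) {z : ℂ} (hz : z ∈ U) :
    ∃ V : Set ℂ, IsOpen V ∧ z ∈ V ∧ ∃ h : ℂ → ℂ, DifferentiableOn ℂ h V ∧
      ((∀ w ∈ V, f w = (h w : OnePoint ℂ)) ∨ ∀ w ∈ V, sphInv (f w) = (h w : OnePoint ℂ)) := by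
  obtain ⟨V, hV, hzV, h, hh, h1 | h1⟩ := hf z hz
  · exact ⟨V, hV, hzV, h, hh, .inl h1⟩
  · refine ⟨V, hV, hzV, h, hh, .inr fun w hw => ?_⟩
    rw [h1 w hw, ← sphInv_coe, sphInv_sphInv]

lemma sphHolomorphicOn_of_exists_chart {f : ℂ → OnePoint ℂ} {U : Set ℂ}
    (hf : ∀ z ∈ U, ∃ V : Set ℂ, IsOpen V ∧ z ∈ V ∧ ∃ h : ℂ → ℂ, DifferentiableOn ℂ h V ∧
      ((∀ w ∈ V, f w = (h w : OnePoint ℂ)) ∨ ∀ w ∈ V, sphInv (f w) = (h w : OnePoint ℂ))) :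
    SphHolomorphicOn f U := by
  intro z hz
  obtain ⟨V, hV, hzV, h, hh, h1 | h1⟩ := hf z hz
  · exact ⟨V, hV, hzV, h, hh, .inl h1⟩
  · refine ⟨V, hV, hzV, h, hh, .inr fun w hw => ?_⟩
    rw [← sphInv_coe, ← h1 w hw, sphInv_sphInv]

lemma SphHolomorphicOn.sphInv_comp {f : ℂ → OnePoint ℂ} {U : Set ℂ}
    (hf : SphHolomorphicOn f U) : SphHolomorphicOn (sphInv ∘ f) U := by
  refine sphHolomorphicOn_of_exists_chart fun z hz => ?_
  obtain ⟨V, hV, hzV, h, hh, h1⟩ := hf.exists_chart hz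
  refine ⟨V, hV, hzV, h, hh, ?_⟩
  simpa only [Function.comp_apply, sphInv_sphInv] using h1.symm

lemma SphHolomorphicOn.mono {f : ℂ → OnePoint ℂ} {U V : Set ℂ} (hf : SphHolomorphicOn f U)
    (hVU : V ⊆ U) : SphHolomorphicOn f V :=
  fun z hz => hf z (hVU hz)

lemma SphHolomorphicOn.exists_hasSphD {f : ℂ → OnePoint ℂ} {U : Set ℂ}
    (hf : SphHolomorphicOn f U) {z : ℂ} (hz : z ∈ U) :
    ∃ V : Set ℂ, IsOpen V ∧ z ∈ V ∧ ∃ h : ℂ → ℂ, DifferentiableOn ℂ h V ∧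
      ∀ w ∈ V, HasSphD f w (‖deriv h w‖ / (1 + ‖h w‖ ^ 2)) := by
  obtain ⟨V, hV, hzV, h, hh, h1⟩ := hf.exists_chart hz
  refine ⟨V, hV, hzV, h, hh, fun w hw => ?_⟩
  have h2 := hasSphD_coe (hh.differentiableAt (hV.mem_nhds hw))
  rcases h1 with h1 | h1
  · exact h2.congr (eventually_of_mem (hV.mem_nhds hw) h1)
  · exact hasSphD_sphInv_comp_iff.1 (h2.congr (eventually_of_mem (hV.mem_nhds hw) h1))

lemma SphHolomorphicOn.hasSphD {f : ℂ → OnePoint ℂ} {U : Set ℂ}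
    (hf : SphHolomorphicOn f U) {z : ℂ} (hz : z ∈ U) : HasSphD f z (sphD f z) := by
  obtain ⟨V, -, hzV, h, -, h1⟩ := hf.exists_hasSphD hz
  rw [(h1 z hzV).sphD_eq]
  exact h1 z hzV

lemma SphHolomorphicOn.continuousAt_sphD {f : ℂ → OnePoint ℂ} {U : Set ℂ}
    (hf : SphHolomorphicOn f U) {z : ℂ} (hz : z ∈ U) : ContinuousAt (sphD f) z := by
  obtain ⟨V, hV, hzV, h, hh, h1⟩ := hf.exists_hasSphD hz
  have hVz := hV.mem_nhds hzV
  have h2 : ContinuousAt (fun w => ‖deriv h w‖ / (1 + ‖h w‖ ^ 2)) z := by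
    have h3 := (hh.deriv hV).continuousOn.continuousAt hVz
    have h4 := hh.continuousOn.continuousAt hVz
    exact h3.norm.div ((h4.norm.pow 2).const_add 1) (by positivity)
  exact h2.congr (eventually_of_mem hVz fun w hw => ((h1 w hw).sphD_eq).symm)

/-! ### Locally uniform limits -/

/-- The affine coordinate on the Riemann sphere, with junk value `0` at infinity. -/
def affineCoord (x : OnePoint ℂ) : ℂ := x.elim 0 id

lemma affineCoord_coe (z : ℂ) : affineCoord (z : OnePoint ℂ) = z := rfl

lemma eq_coe_of_le_sphDist_infty {x : OnePoint ℂ} (hx : 1 / 3 ≤ sphDist x OnePoint.infty) :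
    x = (affineCoord x : OnePoint ℂ) ∧ ‖affineCoord x‖ ≤ 3 := by
  induction x using OnePoint.rec with
  | infty =>
    rw [sphDist_infty_infty] at hx
    norm_num at hx
  | coe w =>
    refine ⟨rfl, ?_⟩
    rw [affineCoord_coe]
    rw [sphDist_coe_infty, div_le_div_iff₀ (by norm_num) (by positivity), one_mul, one_mul,
      Real.sqrt_le_left (by norm_num)] at hx
    nlinarith [norm_nonneg w]

lemma norm_sub_le_sphDist {a b : ℂ} (ha : ‖a‖ ≤ 3) (hb : ‖b‖ ≤ 3) :
    ‖a - b‖ ≤ 10 * sphDist a b := by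
  have key : ∀ c : ℂ, ‖c‖ ≤ 3 → √(1 + ‖c‖ ^ 2) ≤ √10 := fun c hc => by
    refine Real.sqrt_le_sqrt ?_
    nlinarith [norm_nonneg c]
  have h10 : √10 * √10 = (10 : ℝ) := Real.mul_self_sqrt (by norm_num)
  have hle : √(1 + ‖a‖ ^ 2) * √(1 + ‖b‖ ^ 2) ≤ 10 := by
    rw [← h10]
    exact mul_le_mul (key a ha) (key b hb) (by positivity) (by positivity)
  rw [sphDist_coe_coe, mul_div_assoc', le_div_iff₀ (by positivity), mul_comm]
  exact mul_le_mul_of_nonneg_right hle (norm_nonneg _)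

lemma le_sphDist_infty_or (x : OnePoint ℂ) :
    2 / 3 ≤ sphDist x OnePoint.infty ∨ 2 / 3 ≤ sphDist (sphInv x) OnePoint.infty := by
  have key : ∀ w : ℂ, ‖w‖ ≤ 1 → 2 / 3 ≤ sphDist (w : OnePoint ℂ) OnePoint.infty := fun w hw => by
    rw [sphDist_coe_infty, div_le_div_iff₀ (by norm_num) (by positivity)]
    have : √(1 + ‖w‖ ^ 2) ≤ 3 / 2 := by
      rw [Real.sqrt_le_left (by norm_num)]
      nlinarith [norm_nonneg w]
    linarith
  induction x using OnePoint.rec with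
  | infty => exact .inr (key 0 (by simp))
  | coe w =>
    rcases le_total ‖w‖ 1 with hw | hw
    · exact .inl (key w hw)
    · have hw0 : w ≠ 0 := norm_pos_iff.1 (by linarith)
      rw [sphInv_coe, if_neg hw0]
      exact .inr (key _ (by rw [norm_inv]; exact inv_le_one_of_one_le₀ hw))

lemma SphHolomorphicOn.differentiableOn_of_eq_coe {f : ℂ → OnePoint ℂ} {V : Set ℂ}
    (hf : SphHolomorphicOn f V) (hV : IsOpen V) {h : ℂ → ℂ}
    (hfh : ∀ z ∈ V, f z = (h z : OnePoint ℂ)) : DifferentiableOn ℂ h V := by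
  intro z hz
  obtain ⟨W, hW, hzW, k, hk, h1⟩ := hf.exists_chart hz
  have hkz := hk.differentiableAt (hW.mem_nhds hzW)
  have hVW : V ∩ W ∈ 𝓝 z := inter_mem (hV.mem_nhds hz) (hW.mem_nhds hzW)
  refine DifferentiableAt.differentiableWithinAt ?_
  rcases h1 with h1 | h1
  · refine hkz.congr_of_eventuallyEq (eventually_of_mem hVW fun w hw => ?_)
    exact OnePoint.coe_injective ((hfh w hw.1).symm.trans (h1 w hw.2))
  · have key : ∀ w ∈ V ∩ W, k w ≠ 0 ∧ h w = (k w)⁻¹ := by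
      intro w hw
      have h2 := h1 w hw.2
      rw [hfh w hw.1, sphInv_coe] at h2
      split_ifs at h2 with h0
      · exact absurd h2.symm (OnePoint.coe_ne_infty _)
      · rw [← OnePoint.coe_injective h2]
        exact ⟨inv_ne_zero h0, (inv_inv _).symm⟩
    exact (hkz.inv (key z ⟨hz, hzW⟩).1).congr_of_eventuallyEq
      (eventually_of_mem hVW fun w hw => (key w hw).2)

/-- Uniform limits of holomorphic maps staying away from infinity. -/
lemma exists_coe_of_tendsto {G : ℕ → ℂ → OnePoint ℂ} {g : ℂ → OnePoint ℂ} {V : Set ℂ}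
    (hV : IsOpen V) (hG : ∀ᶠ n in atTop, SphHolomorphicOn (G n) V)
    (hlim : ∀ ε > 0, ∀ᶠ n in atTop, ∀ z ∈ V, sphDist (G n z) (g z) < ε)
    (hg : ∀ z ∈ V, 1 / 2 ≤ sphDist (g z) OnePoint.infty) :
    (∃ h : ℂ → ℂ, DifferentiableOn ℂ h V ∧ ∀ z ∈ V, g z = (h z : OnePoint ℂ)) ∧
      ∀ z ∈ V, Tendsto (fun n => sphD (G n) z) atTop (𝓝 (sphD g z)) := by
  have hgV : ∀ z ∈ V, g z = (affineCoord (g z) : OnePoint ℂ) ∧ ‖affineCoord (g z)‖ ≤ 3 :=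
    fun z hz => eq_coe_of_le_sphDist_infty (by linarith [hg z hz])
  have hGV : ∀ᶠ n in atTop, ∀ z ∈ V, G n z = (affineCoord (G n z) : OnePoint ℂ) ∧
      ‖affineCoord (G n z)‖ ≤ 3 := by
    filter_upwards [hlim (1 / 6) (by norm_num)] with n hn z hz
    refine eq_coe_of_le_sphDist_infty ?_
    linarith [hg z hz, hn z hz, sphDist_triangle (g z) (G n z) OnePoint.infty,
      sphDist_comm (g z) (G n z)]
  have hdiff : ∀ᶠ n in atTop, DifferentiableOn ℂ (fun z => affineCoord (G n z)) V := by
    filter_upwards [hG, hGV] with n hn hn'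
    exact hn.differentiableOn_of_eq_coe hV fun z hz => (hn' z hz).1
  have hunif : TendstoLocallyUniformlyOn (fun n z => affineCoord (G n z))
      (fun z => affineCoord (g z)) atTop V := by
    refine TendstoUniformlyOn.tendstoLocallyUniformlyOn ?_
    rw [Metric.tendstoUniformlyOn_iff]
    intro ε hε
    filter_upwards [hGV, hlim (ε / 10) (by positivity)] with n hn hn' z hz
    have h1 := norm_sub_le_sphDist (hgV z hz).2 (hn z hz).2
    rw [← (hgV z hz).1, ← (hn z hz).1, sphDist_comm] at h1
    rw [dist_eq_norm]
    linarith [hn' z hz]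
  have hh := hunif.differentiableOn hdiff hV
  refine ⟨⟨_, hh, fun z hz => (hgV z hz).1⟩, fun z hz => ?_⟩
  have hVz := hV.mem_nhds hz
  have h1 := (hunif.deriv hdiff hV).tendsto_at hz
  have h2 := hunif.tendsto_at hz
  have h3 := h1.norm.div ((h2.norm.pow 2).const_add 1) (by positivity)
  have h4 := ((hasSphD_coe (hh.differentiableAt hVz)).congr
    (eventually_of_mem hVz fun w hw => (hgV w hw).1)).sphD_eq
  rw [h4]
  refine h3.congr' ?_
  filter_upwards [hdiff, hGV] with n hn hn'
  exact (((hasSphD_coe (hn.differentiableAt hVz)).congr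
    (eventually_of_mem hVz fun w hw => (hn' w hw).1)).sphD_eq).symm

lemma sphD_sphInv_comp (f : ℂ → OnePoint ℂ) (z : ℂ) : sphD (sphInv ∘ f) z = sphD f z := by
  simp only [sphD, Function.comp_apply, sphDist_sphInv]

/-- Uniform limits of holomorphic maps into the sphere, near a point of continuity of the
limit. -/
lemma exists_chart_of_tendsto {G : ℕ → ℂ → OnePoint ℂ} {g : ℂ → OnePoint ℂ} {U : Set ℂ}
    {z : ℂ} (hU : U ∈ 𝓝 z) (hG : ∀ᶠ n in atTop, SphHolomorphicOn (G n) U)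
    (hlim : ∀ ε > 0, ∀ᶠ n in atTop, ∀ z ∈ U, sphDist (G n z) (g z) < ε)
    (hg : Tendsto (fun w => sphDist (g w) (g z)) (𝓝 z) (𝓝 0)) :
    (∃ V : Set ℂ, IsOpen V ∧ z ∈ V ∧ ∃ h : ℂ → ℂ, DifferentiableOn ℂ h V ∧
      ((∀ w ∈ V, g w = (h w : OnePoint ℂ)) ∨ ∀ w ∈ V, sphInv (g w) = (h w : OnePoint ℂ))) ∧
      Tendsto (fun n => sphD (G n) z) atTop (𝓝 (sphD g z)) := by
  obtain ⟨V, hVs, hV, hzV⟩ := mem_nhds_iff.1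
    (inter_mem hU (hg.eventually_lt_const (show (0 : ℝ) < 1 / 6 by norm_num)))
  have hGV : ∀ᶠ n in atTop, SphHolomorphicOn (G n) V :=
    hG.mono fun n hn => hn.mono fun w hw => (hVs hw).1
  have hlimV : ∀ ε > 0, ∀ᶠ n in atTop, ∀ w ∈ V, sphDist (G n w) (g w) < ε :=
    fun ε hε => (hlim ε hε).mono fun n hn w hw => hn w (hVs hw).1
  have hgV : ∀ w ∈ V, sphDist (g w) (g z) < 1 / 6 := fun w hw => (hVs hw).2
  rcases le_sphDist_infty_or (g z) with h | h
  · obtain ⟨⟨k, hk, hk'⟩, ht⟩ := exists_coe_of_tendsto hV hGV hlimV fun w hw => by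
      linarith [hgV w hw, sphDist_triangle (g z) (g w) OnePoint.infty, sphDist_comm (g z) (g w)]
    exact ⟨⟨V, hV, hzV, k, hk, .inl hk'⟩, ht z hzV⟩
  · obtain ⟨⟨k, hk, hk'⟩, ht⟩ := exists_coe_of_tendsto (G := fun n => sphInv ∘ G n)
      (g := sphInv ∘ g) hV (hGV.mono fun n hn => hn.sphInv_comp)
      (by simpa only [Function.comp_apply, sphDist_sphInv] using hlimV) fun w hw => by
        have h1 := sphDist_triangle (sphInv (g z)) (sphInv (g w)) OnePoint.infty
        rw [sphDist_sphInv, sphDist_comm (g z)] at h1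
        rw [Function.comp_apply]
        linarith [hgV w hw]
    refine ⟨⟨V, hV, hzV, k, hk, .inr hk'⟩, ?_⟩
    simpa only [sphD_sphInv_comp] using ht z hzV

/-- An Arzelà–Ascoli theorem for maps into the sphere that are eventually locally uniformly
Lipschitz. -/
lemma exists_sphLocUnifOn_subseq {F : ℕ → ℂ → OnePoint ℂ} {U : Set ℂ}
    (hF : ∀ z ∈ U, ∃ r > 0, ∃ M : ℝ, ∀ᶠ n in atTop, ∀ x ∈ Metric.ball z r,
      ∀ y ∈ Metric.ball z r, sphDist (F n x) (F n y) ≤ M * ‖x - y‖) :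
    ∃ φ : ℕ → ℕ, StrictMono φ ∧ ∃ g : ℂ → OnePoint ℂ, SphLocUnifOn (F ∘ φ) g U := by
  obtain ⟨a, -, φ, hφ, ha⟩ :=
    (isCompact_univ_pi fun _ : ℕ => isCompact_range_stereo).tendsto_subseq
      (x := fun n j => stereo (F n (TopologicalSpace.denseSeq ℂ j)))
      fun n j _ => mem_range_self _
  rw [tendsto_pi_nhds] at ha
  have hcau : ∀ z ∈ U, ∀ ε > 0, ∃ ρ > 0, ∀ᶠ N in atTop, ∀ k ≥ N, ∀ l ≥ N,
      ∀ x ∈ Metric.ball z ρ, sphDist (F (φ k) x) (F (φ l) x) < ε := by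
    intro z hz ε hε
    obtain ⟨r, hr, M, hM⟩ := hF z hz
    set L := |M| + 1 with hL
    have hL0 : 0 < L := by positivity
    have hML : M ≤ L := (le_abs_self M).trans (by linarith)
    set ρ := min r (ε / (6 * L)) with hρ
    have hρ0 : 0 < ρ := lt_min hr (by positivity)
    obtain ⟨j, hj⟩ := (TopologicalSpace.denseRange_denseSeq ℂ).exists_mem_open
      Metric.isOpen_ball (Metric.nonempty_ball.2 hρ0 : (Metric.ball z ρ).Nonempty)
    set q := TopologicalSpace.denseSeq ℂ j
    have hjc : CauchySeq fun k => stereo (F (φ k) q) := (ha j).cauchySeq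
    obtain ⟨N, hN⟩ := Metric.cauchySeq_iff.1 hjc (ε / 3) (by positivity)
    have hM' := hφ.tendsto_atTop.eventually hM
    obtain ⟨N', hN'⟩ := eventually_atTop.1 hM'
    refine ⟨ρ, hρ0, ?_⟩
    filter_upwards [eventually_ge_atTop N, eventually_ge_atTop N'] with n hn hn' k hk l hl x hx
    have hsub : Metric.ball z ρ ⊆ Metric.ball z r := Metric.ball_subset_ball (min_le_left _ _)
    have hxq : L * ‖x - q‖ < ε / 3 := by
      have h1 : ‖x - q‖ < 2 * (ε / (6 * L)) := by
        rw [← dist_eq_norm]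
        have h2 : ρ ≤ ε / (6 * L) := min_le_right _ _
        linarith [dist_triangle_right x q z, Metric.mem_ball.1 hx, Metric.mem_ball.1 hj]
      calc L * ‖x - q‖ < L * (2 * (ε / (6 * L))) := by gcongr
        _ = ε / 3 := by field_simp; ring
    have hlip : ∀ m ≥ n, sphDist (F (φ m) x) (F (φ m) q) < ε / 3 := fun m hm =>
      ((hN' m (hn'.trans hm) x (hsub hx) q (hsub hj)).trans
        (mul_le_mul_of_nonneg_right hML (norm_nonneg _))).trans_lt hxq
    have h3 := hN k (hn.trans hk) l (hn.trans hl)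
    rw [dist_stereo] at h3
    linarith [hlip k hk, hlip l hl, sphDist_triangle (F (φ k) x) (F (φ k) q) (F (φ l) x),
      sphDist_triangle (F (φ k) q) (F (φ l) q) (F (φ l) x),
      sphDist_comm (F (φ l) q) (F (φ l) x)]
  have hlim : ∀ z ∈ U, ∃ x : OnePoint ℂ,
      Tendsto (fun k => stereo (F (φ k) z)) atTop (𝓝 (stereo x)) := by
    intro z hz
    have hc : CauchySeq fun k => stereo (F (φ k) z) := by
      refine Metric.cauchySeq_iff.2 fun ε hε => ?_
      obtain ⟨ρ, hρ, h⟩ := hcau z hz ε hε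
      obtain ⟨N, hN⟩ := h.exists
      refine ⟨N, fun k hk l hl => ?_⟩
      rw [dist_stereo]
      exact hN k hk l hl z (Metric.mem_ball_self hρ)
    obtain ⟨y, ⟨x, rfl⟩, hy⟩ := cauchySeq_tendsto_of_isComplete
      isCompact_range_stereo.isComplete (fun k => mem_range_self _) hc
    exact ⟨x, hy⟩
  choose! g hg using hlim
  refine ⟨φ, hφ, g, fun K hKU hK ε hε => ?_⟩
  refine hK.induction_on (p := fun s => ∀ᶠ n in atTop, ∀ z ∈ s ∩ U, sphDist ((F ∘ φ) n z) (g z) < ε)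
    (by simp) (fun s t hst ht => ?_) (fun s t hs ht => ?_) (fun z hz => ?_) |>.mono
    fun n hn z hz => hn z ⟨hz, hKU hz⟩
  · exact ht.mono fun n hn z hz => hn z ⟨hst hz.1, hz.2⟩
  · filter_upwards [hs, ht] with n hns hnt z hz
    exact hz.1.elim (fun h => hns z ⟨h, hz.2⟩) fun h => hnt z ⟨h, hz.2⟩
  · obtain ⟨ρ, hρ, h⟩ := hcau z (hKU hz) (ε / 2) (by positivity)
    refine ⟨Metric.ball z ρ, mem_nhdsWithin_of_mem_nhds (Metric.ball_mem_nhds z hρ), ?_⟩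
    filter_upwards [h] with n hn x hx
    have h1 : Tendsto (fun l => dist (stereo (F (φ n) x)) (stereo (F (φ l) x))) atTop
        (𝓝 (dist (stereo (F (φ n) x)) (stereo (g x)))) := tendsto_const_nhds.dist (hg x hx.2)
    simp only [dist_stereo] at h1
    have h2 := le_of_tendsto h1 ((eventually_ge_atTop n).mono fun l hl =>
      (hn n le_rfl l hl x hx.1).le)
    rw [Function.comp_apply]
    linarith

/-! ### Rescaling -/

lemma tendsto_sphDist_of_sphLocUnifOn {F : ℕ → ℂ → OnePoint ℂ} {g : ℂ → OnePoint ℂ} {U : Set ℂ}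
    (h : SphLocUnifOn F g U) {x y : ℂ} (hx : x ∈ U) (hy : y ∈ U) :
    Tendsto (fun n => sphDist (F n x) (F n y)) atTop (𝓝 (sphDist (g x) (g y))) := by
  have key : ∀ z ∈ U, Tendsto (fun n => stereo (F n z)) atTop (𝓝 (stereo (g z))) := by
    intro z hz
    refine Metric.tendsto_nhds.2 fun ε hε => ?_
    filter_upwards [h {z} (singleton_subset_iff.2 hz) isCompact_singleton ε hε] with n hn
    rw [dist_stereo]
    exact hn z rfl
  simpa only [dist_stereo] using (key x hx).dist (key y hy)

/-- A maximum point of the spherical derivative weighted by the distance to the boundary of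
a disc. -/
lemma SphHolomorphicOn.exists_weighted_max {f : ℂ → OnePoint ℂ} {U : Set ℂ}
    (hf : SphHolomorphicOn f U) {z₀ : ℂ} {r : ℝ} (hr : 0 < r)
    (hrU : Metric.closedBall z₀ r ⊆ U) :
    ∃ p ∈ Metric.closedBall z₀ r, ∀ x ∈ Metric.closedBall z₀ r,
      (r - dist x z₀) * sphD f x ≤ (r - dist p z₀) * sphD f p := by
  have hcont : ContinuousOn (fun x => (r - dist x z₀) * sphD f x) (Metric.closedBall z₀ r) :=
    fun x hx => ContinuousWithinAt.mul (by fun_prop)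
      (hf.continuousAt_sphD (hrU hx)).continuousWithinAt
  exact (isCompact_closedBall z₀ r).exists_isMaxOn (Metric.nonempty_closedBall.2 hr.le) hcont

/-- The rescaling estimate at a weighted maximum point of the spherical derivative. -/
lemma SphHolomorphicOn.rescale {f : ℂ → OnePoint ℂ} {U : Set ℂ} (hf : SphHolomorphicOn f U)
    {z₀ p : ℂ} {r m c R : ℝ} (hrU : Metric.closedBall z₀ r ⊆ U)
    (hm : m = (r - dist p z₀) * sphD f p)
    (hmax : ∀ x ∈ Metric.closedBall z₀ r, (r - dist x z₀) * sphD f x ≤ m)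
    (hc : 0 < c) (hs : 0 < sphD f p) (hR : c * R < m) {ζ : ℂ} (hζ : ‖ζ‖ ≤ R) :
    p + (c / sphD f p : ℝ) * ζ ∈ U ∧
      HasSphD (fun ζ => f (p + (c / sphD f p : ℝ) * ζ)) ζ
        (c / sphD f p * sphD f (p + (c / sphD f p : ℝ) * ζ)) ∧
      c / sphD f p * sphD f (p + (c / sphD f p : ℝ) * ζ) ≤ c * (1 - c * R / m)⁻¹ := by
  set s := sphD f p
  have hR0 : 0 ≤ R := (norm_nonneg ζ).trans hζ
  have hm0 : 0 < m := (by positivity : 0 ≤ c * R).trans_lt hR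
  have hρ : 0 < c / s := by positivity
  set x := p + (c / s : ℝ) * ζ with hx
  have hxp : dist x p ≤ c / s * R := by
    rw [dist_eq_norm, hx, add_sub_cancel_left, norm_mul, Complex.norm_real,
      Real.norm_of_nonneg hρ.le]
    exact mul_le_mul_of_nonneg_left hζ hρ.le
  have hd : r - dist p z₀ = m / s := by
    rw [hm]
    field_simp
  have hpos : 0 < (m - c * R) / s := div_pos (sub_pos.2 hR) hs
  have hxr : (m - c * R) / s ≤ r - dist x z₀ := by
    have : (m - c * R) / s = m / s - c / s * R := by ring
    linarith [dist_triangle x p z₀]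
  have hxB : x ∈ Metric.closedBall z₀ r := by
    rw [Metric.mem_closedBall]
    linarith
  have hD := hf.hasSphD (hrU hxB)
  refine ⟨hrU hxB, hD.comp_affine hρ, ?_⟩
  have h1 : sphD f x ≤ m / ((m - c * R) / s) := by
    refine ((le_div_iff₀' (hpos.trans_le hxr)).2 (hmax x hxB)).trans ?_
    gcongr
  calc c / s * sphD f x ≤ c / s * (m / ((m - c * R) / s)) := by gcongr
    _ = c * (1 - c * R / m)⁻¹ := by
      have : m - c * R ≠ 0 := (sub_pos.2 hR).ne'
      have h2 : 1 - c * R / m = (m - c * R) / m := by field_simp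
      rw [h2]
      field_simp

/-- A closed property admitting a family of maps on `U` whose spherical derivatives are not
locally bounded is satisfied by an entire map with bounded spherical derivative. -/
lemma IsClosedProperty.exists_entire {P : Set ℂ → (ℂ → OnePoint ℂ) → Prop}
    (hP : IsClosedProperty P) {U : Set ℂ} (hU : IsOpen U) (hUc : IsConnected U) {z₀ : ℂ} {r : ℝ}
    (hr : 0 < r) (hrU : Metric.closedBall z₀ r ⊆ U) {F : ℕ → ℂ → OnePoint ℂ}
    (hF : ∀ k, P U (F k))
    (hbig : ∀ k : ℕ, ∃ x ∈ Metric.ball z₀ (r / 2), (k : ℝ) < sphD (F k) x)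
    {c : ℝ} (hc : 0 < c) :
    ∃ f : ℂ → OnePoint ℂ, P univ f ∧ sphD f 0 = c ∧ ∀ z, sphD f z ≤ c := by
  have hFh := fun k => hP.mem_holo U (F k) hU hUc (hF k)
  choose p hpB hpmax using fun k => (hFh k).exists_weighted_max hr hrU
  set m : ℕ → ℝ := fun k => (r - dist (p k) z₀) * sphD (F k) (p k) with hm
  have hmk : ∀ k : ℕ, r / 2 * k ≤ m k ∧ 0 < m k := by
    intro k
    obtain ⟨x, hx, hxk⟩ := hbig k
    rw [Metric.mem_ball] at hx
    have h1 := hpmax k x (by rw [Metric.mem_closedBall]; linarith)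
    have hk : (0 : ℝ) ≤ k := Nat.cast_nonneg k
    have h2 : r / 2 * k ≤ (r - dist x z₀) * sphD (F k) x :=
      mul_le_mul (by linarith) hxk.le hk (by linarith)
    have h3 : 0 < (r - dist x z₀) * sphD (F k) x := mul_pos (by linarith) (by linarith)
    exact ⟨h2.trans h1, h3.trans_le h1⟩
  have hm_top : Tendsto m atTop atTop :=
    tendsto_atTop_mono (fun k => (hmk k).1)
      (tendsto_natCast_atTop_atTop.const_mul_atTop (by positivity))
  have hs : ∀ k, 0 < sphD (F k) (p k) := fun k =>
    pos_of_mul_pos_right (hmk k).2 (sub_nonneg.2 (hpB k))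
  set ρ : ℕ → ℝ := fun k => c / sphD (F k) (p k) with hρ
  have hρ0 : ∀ k, 0 < ρ k := fun k => div_pos hc (hs k)
  set G : ℕ → ℂ → OnePoint ℂ := fun k ζ => F k (p k + ρ k * ζ) with hG
  have hres : ∀ k R, c * R < m k → ∀ ζ : ℂ, ‖ζ‖ ≤ R → p k + ρ k * ζ ∈ U ∧
      HasSphD (G k) ζ (ρ k * sphD (F k) (p k + ρ k * ζ)) ∧
      ρ k * sphD (F k) (p k + ρ k * ζ) ≤ c * (1 - c * R / m k)⁻¹ := fun k R hR ζ hζ =>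
    (hFh k).rescale hrU rfl (hpmax k) hc (hs k) hR hζ
  have hPG : ∀ k R, c * R < m k → ∀ Ω ⊆ Metric.closedBall (0 : ℂ) R, IsOpen Ω →
      IsConnected Ω → P Ω (G k) := by
    intro k R hR Ω hΩ hΩo hΩc
    refine hP.comp Ω U (fun ζ => p k + ρ k * ζ) (F k) hΩo hΩc hU hUc (by fun_prop)
      (fun ζ hζ => (hres k R hR ζ (mem_closedBall_zero_iff.1 (hΩ hζ))).1) (fun ζ _ => ?_) (hF k)
    have : HasDerivAt (fun ζ : ℂ => p k + ρ k * ζ) (ρ k * 1) ζ :=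
      ((hasDerivAt_id ζ).const_mul _).const_add _
    rw [this.deriv, mul_one]
    exact_mod_cast (hρ0 k).ne'
  have hlip : ∀ k R, c * R < m k → ∀ x ∈ Metric.closedBall (0 : ℂ) R,
      ∀ y ∈ Metric.closedBall (0 : ℂ) R,
      sphDist (G k x) (G k y) ≤ c * (1 - c * R / m k)⁻¹ * ‖x - y‖ := by
    intro k R hR x hx y hy
    have h1 := hres k R hR
    exact sphDist_le_of_hasSphD_le (convex_closedBall 0 R)
      (fun ζ hζ => (h1 ζ (mem_closedBall_zero_iff.1 hζ)).2.1)
      (fun ζ hζ => (h1 ζ (mem_closedBall_zero_iff.1 hζ)).2.2) hy hx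
  have hbd : ∀ R, Tendsto (fun k => c * (1 - c * R / m k)⁻¹) atTop (𝓝 c) := fun R => by
    have h1 := ((hm_top.const_div_atTop (c * R)).const_sub 1).inv₀ (by norm_num)
    simpa using h1.const_mul c
  obtain ⟨φ, hφ, g, hg⟩ := exists_sphLocUnifOn_subseq (F := G) (U := univ) fun z _ => by
    refine ⟨1, one_pos, 2 * c, ?_⟩
    filter_upwards [hm_top.eventually_gt_atTop (c * (‖z‖ + 1)),
      (hbd (‖z‖ + 1)).eventually_lt_const (show c < 2 * c by linarith)] with k hk hk' x hx y hy
    have hsub : Metric.ball z 1 ⊆ Metric.closedBall (0 : ℂ) (‖z‖ + 1) := fun w hw => by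
      rw [mem_closedBall_zero_iff]
      rw [mem_ball_iff_norm] at hw
      linarith [norm_le_norm_add_norm_sub z w, norm_sub_rev z w]
    exact (hlip k _ hk x (hsub hx) y (hsub hy)).trans
      (mul_le_mul_of_nonneg_right hk'.le (norm_nonneg _))
  have hmφ := hm_top.comp hφ.tendsto_atTop
  have hglip : ∀ x y, sphDist (g x) (g y) ≤ c * ‖x - y‖ := by
    intro x y
    set R := max ‖x‖ ‖y‖
    refine le_of_tendsto_of_tendsto
      (tendsto_sphDist_of_sphLocUnifOn hg (mem_univ x) (mem_univ y))
      (((hbd R).comp hφ.tendsto_atTop).mul_const ‖x - y‖) ?_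
    filter_upwards [hmφ.eventually_gt_atTop (c * R)] with k hk
    exact hlip (φ k) R hk x (mem_closedBall_zero_iff.2 (le_max_left _ _)) y
      (mem_closedBall_zero_iff.2 (le_max_right _ _))
  have hgcont : ∀ z, Tendsto (fun w => sphDist (g w) (g z)) (𝓝 z) (𝓝 0) := fun z => by
    refine squeeze_zero (fun _ => sphDist_nonneg _ _) (fun w => hglip w z) ?_
    have : Continuous fun w => c * ‖w - z‖ := by fun_prop
    simpa using this.tendsto z
  have hloc := fun z : ℂ => exists_chart_of_tendsto (G := G ∘ φ) (g := g) (z := z)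
    (Metric.ball_mem_nhds z one_pos) (by
      filter_upwards [hmφ.eventually_gt_atTop (c * (‖z‖ + 1))] with k hk
      have hc1 : IsConnected (Metric.ball z 1) :=
        (convex_ball z 1).isConnected (Metric.nonempty_ball.2 one_pos)
      refine hP.mem_holo _ _ Metric.isOpen_ball hc1
        (hPG (φ k) _ hk _ (fun w hw => ?_) Metric.isOpen_ball hc1)
      rw [mem_closedBall_zero_iff]
      rw [mem_ball_iff_norm] at hw
      linarith [norm_le_norm_add_norm_sub z w, norm_sub_rev z w])
    (fun ε hε => (hg _ (subset_univ _) (isCompact_closedBall z 1) ε hε).mono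
      fun n hn w hw => hn w (Metric.ball_subset_closedBall hw)) (hgcont z)
  have hgh : SphHolomorphicOn g univ := sphHolomorphicOn_of_exists_chart fun z _ => (hloc z).1
  refine ⟨g, ?_, ?_, fun z => ?_⟩
  · refine hP.exhaust univ g isOpen_univ isConnected_univ hgh fun Ω hΩ hΩc hΩk _ => ?_
    obtain ⟨R, hR⟩ := hΩk.isBounded.subset_closedBall (0 : ℂ)
    obtain ⟨N, hN⟩ := eventually_atTop.1 (hmφ.eventually_gt_atTop (c * R))
    refine hP.closed Ω g (fun n => G (φ (n + N))) hΩ hΩc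
      (fun n => hPG _ R (hN _ (Nat.le_add_left N n)) Ω (subset_closure.trans hR) hΩ hΩc) ?_
      (hgh.mono (subset_univ _))
    intro K _ hK ε hε
    exact (tendsto_add_atTop_nat N).eventually (hg K (subset_univ _) hK ε hε)
  · refine tendsto_nhds_unique (hloc 0).2 (tendsto_const_nhds.congr fun k => ?_)
    have h1 := (hres (φ k) 0 (by simpa using (hmk (φ k)).2) 0 (by simp)).2.1.sphD_eq
    rw [Function.comp_apply, h1, mul_zero, add_zero]
    exact (div_mul_cancel₀ c (hs (φ k)).ne').symm
  · exact (hgh.hasSphD (mem_univ z)).le_of_lipschitz (Eventually.of_forall fun w => hglip w z)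

/-- Zalcman-type lemma: a closed property is either compact, or there exists `f ∈ 𝒫(ℂ)`
with `|∇f|ₑ(0) = 1` and `|∇f|ₑ ≤ 1` on `ℂ`, where `|∇f|ₑ = 2√2 ⬝ f^#` is `2√2` times the
spherical derivative. -/
theorem zalcman_dichotomy
    (P : Set ℂ → (ℂ → OnePoint ℂ) → Prop) (hP : IsClosedProperty P) :
    IsCompactProperty P ∨
      ∃ f : ℂ → OnePoint ℂ, P Set.univ f ∧
        2 * Real.sqrt 2 * sphD f 0 = 1 ∧ ∀ z : ℂ, 2 * Real.sqrt 2 * sphD f z ≤ 1 := by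
  by_contra hcon
  refine hcon (.inl ⟨hP, fun U hU hUc F hF => exists_sphLocUnifOn_subseq fun z hz => ?_⟩)
  by_contra hnot
  push Not at hnot
  obtain ⟨r, hr, hrU⟩ := Metric.nhds_basis_closedBall.mem_iff.1 (hU.mem_nhds hz)
  have hbig : ∀ k : ℕ, ∃ n, ∃ x ∈ Metric.ball z (r / 2), (k : ℝ) < sphD (F n) x := by
    intro k
    obtain ⟨n, x, hx, y, hy, hxy⟩ := (hnot (r / 2) (by positivity) k).exists
    refine ⟨n, ?_⟩
    by_contra! hle
    refine hxy.not_ge (sphDist_le_of_hasSphD_le (convex_ball z (r / 2)) (fun w hw => ?_) hle hy hx)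
    exact (hP.mem_holo U _ hU hUc (hF n)).hasSphD
      (hrU (Metric.ball_subset_closedBall (Metric.ball_subset_ball (by linarith) hw)))
  choose n hn using hbig
  obtain ⟨f, hf, hf0, hfle⟩ := hP.exists_entire hU hUc hr hrU (fun k => hF (n k)) hn
    (c := (2 * √2)⁻¹) (by positivity)
  have h2 : (0 : ℝ) < 2 * √2 := by positivity
  refine hcon (.inr ⟨f, hf, ?_, fun w => ?_⟩)
  · rw [hf0, mul_inv_cancel₀ h2.ne']
  · exact (mul_le_mul_of_nonneg_left (hfle w) h2.le).trans_eq (mul_inv_cancel₀ h2.ne')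

end
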